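/- Let (w, i, j) ∈ Γ(W) and suppose j is the only right descent of w, i.e. D_R(w) = {j}. The following are equivalent: (1) there exist v ∈ W and i′ ∈ I with (v, i′, j) ∈ Γ(W), (w, i, j) →_L (v, i′, j), ℓ(v) < ℓ(w), and D_R(v) = {j}; (2) w has more than one left descent. -/

import Mathlib

open CoxeterSystem

namespace NilpotencyIndices

variable {B : Type*} {W : Type*} [Group W] {M : CoxeterMatrix B}

/-- The set `Γ(W)` of triples `(w, i, j)` with `ℓ(sᵢ w sⱼ) = ℓ(w) - 2`
(stated as `ℓ(sᵢ w sⱼ) + 2 = ℓ(w)` to avoid truncated subtraction). -/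
def InGamma (cs : CoxeterSystem M W) (x : W × B × B) : Prop :=
  cs.length (cs.simple x.2.1 * x.1 * cs.simple x.2.2) + 2 = cs.length x.1

/-- The weak left (Bruhat) order: `v ≤_L w` iff `ℓ(v) + ℓ(w v⁻¹) = ℓ(w)`. -/
def WeakLeftLE (cs : CoxeterSystem M W) (v w : W) : Prop :=
  cs.length v + cs.length (w * v⁻¹) = cs.length w

/-- The weak right (Bruhat) order: `v ≤_R w` iff `ℓ(v) + ℓ(v⁻¹ w) = ℓ(w)`. -/
def WeakRightLE (cs : CoxeterSystem M W) (v w : W) : Prop :=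
  cs.length v + cs.length (v⁻¹ * w) = cs.length w

/-- `v(α_a) = α_b`: the group-theoretic condition `v sₐ v⁻¹ = s_b` and `ℓ(v sₐ) = ℓ(v) + 1`. -/
def MapsSimple (cs : CoxeterSystem M W) (v : W) (a b : B) : Prop :=
  v * cs.simple a * v⁻¹ = cs.simple b ∧ cs.length (v * cs.simple a) = cs.length v + 1

/-- `(w, i, j) →_L (u, i', j')` iff both triples are in `Γ(W)`, `u ≤_L w`, `j' = j`, and
`(w u⁻¹)(α_{i'}) = α_i`. -/
def RedL (cs : CoxeterSystem M W) (x y : W × B × B) : Prop :=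
  InGamma cs x ∧ InGamma cs y ∧ WeakLeftLE cs y.1 x.1 ∧ y.2.2 = x.2.2 ∧
    MapsSimple cs (x.1 * y.1⁻¹) y.2.1 x.2.1

/-- `(w, i, j) →_R (u, i', j')` iff both triples are in `Γ(W)`, `u ≤_R w`, `i' = i`, and
`(u⁻¹ w)(α_j) = α_{j'}`. -/
def RedR (cs : CoxeterSystem M W) (x y : W × B × B) : Prop :=
  InGamma cs x ∧ InGamma cs y ∧ WeakRightLE cs y.1 x.1 ∧ y.2.1 = x.2.1 ∧
    MapsSimple cs (y.1⁻¹ * x.1) x.2.2 y.2.2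

/-- `→`: the reflexive-transitive closure of the union of `→_L` and `→_R`. -/
def Red (cs : CoxeterSystem M W) : (W × B × B) → (W × B × B) → Prop :=
  Relation.ReflTransGen (fun x y => RedL cs x y ∨ RedR cs x y)

/-- `↔`: the equivalence relation generated by `→`. -/
def EquivRed (cs : CoxeterSystem M W) : (W × B × B) → (W × B × B) → Prop :=
  Relation.EqvGen (Red cs)

/-- The alternating word `a, b, a, b, …` with `n` letters, starting with `a`. -/
def altWord (a b : B) : ℕ → List B
  | 0 => []
  | n + 1 => a :: altWord b a n

/-- `w₀(a, b)`: the alternating product `sₐ s_b sₐ ⋯` with `M a b` factors, the longest element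
of the subgroup generated by `sₐ` and `s_b` when `M a b` is finite (i.e. nonzero). -/
def w0 (cs : CoxeterSystem M W) (a b : B) : W :=
  cs.wordProd (altWord a b (M a b))

/-- An element is bigrassmannian if it has exactly one left descent and exactly one
right descent. -/
def Bigrassmannian (cs : CoxeterSystem M W) (w : W) : Prop :=
  (∃! i, cs.IsLeftDescent w i) ∧ (∃! j, cs.IsRightDescent w j)

/-- The support of `w`: the set of indices appearing in some reduced word for `w`. -/
def Supp (cs : CoxeterSystem M W) (w : W) : Set B :=
  {i | ∃ l : List B, cs.IsReduced l ∧ cs.wordProd l = w ∧ i ∈ l}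

/-- The relation `(w, i, j) →_{(k,L)} (u, i', j')`. -/
def RedkL (cs : CoxeterSystem M W) (k : B) (x y : W × B × B) : Prop :=
  cs.length y.1 < cs.length x.1 ∧ RedR cs (x.1 * cs.simple k, x.2.1, x.2.2) x ∧
    RedL cs (x.1 * cs.simple k, x.2.1, x.2.2) y ∧ WeakLeftLE cs y.1 x.1

/-- The relation `(w, i, j) →_{(k,R)} (u, i', j')`. -/
def RedkR (cs : CoxeterSystem M W) (k : B) (x y : W × B × B) : Prop :=
  cs.length y.1 < cs.length x.1 ∧ RedL cs (cs.simple k * x.1, x.2.1, x.2.2) x ∧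
    RedR cs (cs.simple k * x.1, x.2.1, x.2.2) y ∧ WeakRightLE cs y.1 x.1

/-- The orthogonality condition for a bigrassmannian element `w` with `D_L(w) = {i}` and
`D_R(w) = {j}`. -/
def OrthCond (cs : CoxeterSystem M W) (w : W) (i j : B) : Prop :=
  (∀ a b : B, M a j = 2 → MapsSimple cs w a b → M b i = 2) ∧
  (∀ a b : B, M a i = 2 → MapsSimple cs w⁻¹ a b → M b j = 2)


section GeometricRepresentation

open Real Module

/-- The coroot of `a` in the geometric representation: the linear form on `B →₀ ℝ` sending the
basis vector of `b` to `-2 cos (π / M a b)` (which is `-2` when `M a b = 0`, i.e. infinite). -/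
noncomputable def coroot (M : CoxeterMatrix B) (a : B) : Dual ℝ (B →₀ ℝ) :=
  Finsupp.linearCombination ℝ fun b => -2 * cos (π / M a b)

theorem coroot_single (M : CoxeterMatrix B) (a b : B) :
    coroot M a (Finsupp.single b 1) = -2 * cos (π / M a b) := by
  simp [coroot]

theorem coroot_single_self (M : CoxeterMatrix B) (a : B) :
    coroot M a (Finsupp.single a 1) = 2 := by
  simp [coroot_single]

/-- The reflections of the geometric representation satisfy the Coxeter relations. -/
theorem isLiftable_reflection (M : CoxeterMatrix B) :
    M.IsLiftable fun a => reflection (coroot_single_self M a) := by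
  intro a b
  rcases eq_or_ne a b with rfl | hab
  · rw [M.diagonal, pow_one]
    refine LinearEquiv.ext fun z => ?_
    rw [LinearEquiv.mul_apply]
    exact involutive_reflection (coroot_single_self M a) z
  rcases Nat.eq_zero_or_pos (M a b) with h0 | hpos
  · rw [h0, pow_zero]
  have hne1 := M.off_diagonal a b hab
  have hba : coroot M b (Finsupp.single a 1) = -2 * cos (π / M a b) := by
    rw [coroot_single, M.symmetric]
  have hab' := coroot_single M a b
  refine LinearEquiv.ext fun z => ?_
  rw [reflection_mul_reflection_pow_apply _ _ (M a b) z _ rfl]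
  rcases eq_or_ne (M a b) 2 with h2 | hne2
  · have hc : cos (π / (2 : ℕ)) = 0 := by simp
    rw [h2, hc] at hba hab'
    simp [h2, hba, hab']
    module
  set m := M a b
  have hm : (3 : ℝ) ≤ m := by
    have : 3 ≤ m := by lia
    exact_mod_cast this
  have hπ := pi_pos
  set θ : ℝ := 2 * (π / m) with hθ
  have hmθ : m * θ = 2 * π := by rw [hθ]; field_simp
  have ht : coroot M a (Finsupp.single b 1) * coroot M b (Finsupp.single a 1) - 2
      = 2 * cos θ := by
    rw [hab', hba, hθ, cos_two_mul]; ring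
  have hsin : sin θ ≠ 0 := by
    refine (sin_pos_of_pos_of_lt_pi (by positivity) ?_).ne'
    nlinarith
  have hS (k : ℤ) : (Polynomial.Chebyshev.S ℝ k).eval (2 * cos θ) = sin ((k + 1) * θ) / sin θ := by
    rw [eq_div_iff hsin, Polynomial.Chebyshev.S_two_mul_real_cos]
  rw [ht]
  simp only [hS]
  obtain ⟨n, hn | hn⟩ := Nat.even_or_odd' m
  · have h1 : ((m : ℤ) - 2) / 2 = n - 1 := by lia
    have h2 : ((m : ℤ) - 1) / 2 = n - 1 := by lia
    have h3 : (((n : ℤ) - 1 : ℤ) + 1 : ℝ) * θ = π := by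
      have : (m : ℝ) = 2 * n := by exact_mod_cast hn
      push_cast
      rw [this] at hmθ
      linarith
    rw [h1, h2, h3]
    simp
  · have h1 : ((m : ℤ) - 2) / 2 = n - 1 := by lia
    have h2 : ((m : ℤ) - 1) / 2 = n := by lia
    have h3 : ((m : ℤ) - 3) / 2 = n - 1 := by lia
    have h4 : (m : ℤ) / 2 = n := by lia
    have h5 : sin (((n : ℤ) + 1 : ℝ) * θ) + sin ((((n : ℤ) - 1 : ℤ) + 1 : ℝ) * θ) = 0 := by
      have : (m : ℝ) = 2 * n + 1 := by exact_mod_cast hn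
      rw [this] at hmθ
      have : ((n : ℤ) + 1 : ℝ) * θ = 2 * π - n * θ := by push_cast; linarith
      rw [this, sin_two_pi_sub]
      simp
    rw [h1, h2, h3, h4, ← add_div, h5]
    simp

theorem simple_injective (cs : CoxeterSystem M W) : Function.Injective cs.simple := by
  intro a b hab
  by_contra hne
  have h := congrArg (cs.lift ⟨_, isLiftable_reflection M⟩) hab
  rw [cs.lift_apply_simple, cs.lift_apply_simple] at h
  have h' := congrArg (fun v : B →₀ ℝ => v a)
    (LinearEquiv.congr_fun h (Finsupp.single a 1))
  simp [reflection_apply, Ne.symm hne] at h'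
  norm_num at h'

end GeometricRepresentation

section InversionParity

open Classical in
/-- The action of `s_i` on pairs `(t, e)`: conjugate `t` by `s_i`, and flip the parity `e` when
`t = s_i`. -/
noncomputable def parityStep (cs : CoxeterSystem M W) (i : B) : Function.End (W × ZMod 2) :=
  fun p => (cs.simple i * p.1 * cs.simple i, p.2 + if p.1 = cs.simple i then 1 else 0)

open Classical in
theorem parityStep_mul_pow_apply (cs : CoxeterSystem M W) (i i' : B) (n : ℕ) (p : W × ZMod 2) :
    ((parityStep cs i * parityStep cs i') ^ n) p =
      ((cs.simple i * cs.simple i') ^ n * p.1 * (cs.simple i' * cs.simple i) ^ n,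
        p.2 + ∑ q ∈ Finset.range (2 * n),
          if p.1 = (cs.simple i' * cs.simple i) ^ q * cs.simple i' then 1 else 0) := by
  induction n with
  | zero => simp [show (1 : Function.End (W × ZMod 2)) p = p from rfl]
  | succ n ih =>
    have hinv : ((cs.simple i * cs.simple i') ^ n)⁻¹ = (cs.simple i' * cs.simple i) ^ n := by
      rw [← inv_pow]; simp
    have hcomm' : (cs.simple i' * cs.simple i) ^ n * cs.simple i'
        = cs.simple i' * (cs.simple i * cs.simple i') ^ n :=
      (SemiconjBy.pow_right (by simp [SemiconjBy, mul_assoc]) n).eq.symm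
    have key (x : W) : (cs.simple i * cs.simple i') ^ n * p.1 * (cs.simple i' * cs.simple i) ^ n
        = x ↔ p.1 = (cs.simple i' * cs.simple i) ^ n * x * (cs.simple i * cs.simple i') ^ n := by
      rw [← hinv]
      constructor
      · rintro rfl; group
      · intro h; rw [h]; group
    have e1 : (cs.simple i * cs.simple i') ^ n * p.1 * (cs.simple i' * cs.simple i) ^ n
        = cs.simple i' ↔ p.1 = (cs.simple i' * cs.simple i) ^ (2 * n) * cs.simple i' := by
      rw [key, mul_assoc, ← hcomm', two_mul, pow_add, mul_assoc]
    have e2 : cs.simple i' * ((cs.simple i * cs.simple i') ^ n * p.1 *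
          (cs.simple i' * cs.simple i) ^ n) * cs.simple i' = cs.simple i
        ↔ p.1 = (cs.simple i' * cs.simple i) ^ (2 * n + 1) * cs.simple i' := by
      have : ∀ x : W, cs.simple i' * x * cs.simple i' = cs.simple i ↔
          x = cs.simple i' * cs.simple i * cs.simple i' := by
        intro x
        constructor
        · intro h; rw [← h]; simp [mul_assoc]
        · rintro rfl; simp [mul_assoc]
      rw [this, key, show 2 * n + 1 = n + 1 + n by ring]
      simp only [pow_add, pow_one, mul_assoc, hcomm']
    rw [pow_succ', show ((parityStep cs i * parityStep cs i') *
      (parityStep cs i * parityStep cs i') ^ n) p = parityStep cs i (parityStep cs i'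
        (((parityStep cs i * parityStep cs i') ^ n) p)) from rfl, ih]
    simp only [parityStep, e1, e2]
    rw [show 2 * (n + 1) = 2 * n + 1 + 1 by ring, Finset.sum_range_succ, Finset.sum_range_succ]
    refine Prod.ext ?_ ?_
    · dsimp only
      rw [pow_succ' (cs.simple i * cs.simple i'), pow_succ (cs.simple i' * cs.simple i)]
      simp only [mul_assoc]
    · simp only [add_assoc]

theorem isLiftable_parityStep (cs : CoxeterSystem M W) : M.IsLiftable (parityStep cs) := by
  classical
  intro i i'
  funext p
  have h1 := cs.simple_mul_simple_pow i i'
  have h2 := cs.simple_mul_simple_pow' i i'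
  rw [parityStep_mul_pow_apply, h1, h2, two_mul, Finset.sum_range_add]
  simp only [pow_add, h2, one_mul, CharTwo.add_self_eq_zero]
  simp [show (1 : Function.End (W × ZMod 2)) p = p from rfl]

/-- The parity of the number of times `t` occurs in the right inversion sequence of any word
for `w`. -/
noncomputable def inversionParity (cs : CoxeterSystem M W) (w t : W) : ZMod 2 :=
  (cs.lift ⟨parityStep cs, isLiftable_parityStep cs⟩ w (t, 0)).2

open Classical in
theorem lift_parityStep_wordProd (cs : CoxeterSystem M W) (ω : List B) (t : W) (e : ZMod 2) :
    cs.lift ⟨parityStep cs, isLiftable_parityStep cs⟩ (cs.wordProd ω) (t, e) =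
      (cs.wordProd ω * t * (cs.wordProd ω)⁻¹, e + (cs.rightInvSeq ω).count t) := by
  induction ω with
  | nil => simp [show (1 : Function.End (W × ZMod 2)) (t, e) = (t, e) from rfl]
  | cons i ω ih =>
    rw [cs.wordProd_cons, map_mul, cs.lift_apply_simple,
      show ∀ f g : Function.End (W × ZMod 2), (f * g) (t, e) = f (g (t, e)) from fun _ _ => rfl,
      ih]
    have : cs.wordProd ω * t * (cs.wordProd ω)⁻¹ = cs.simple i ↔
        (cs.wordProd ω)⁻¹ * cs.simple i * cs.wordProd ω = t := by
      constructor
      · intro h; rw [← h]; group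
      · rintro rfl; group
    simp only [parityStep, this, CoxeterSystem.rightInvSeq, List.count_cons, beq_iff_eq]
    refine Prod.ext ?_ ?_
    · simp [mul_assoc]
    · push_cast
      ring

open Classical in
theorem inversionParity_wordProd (cs : CoxeterSystem M W) (ω : List B) (t : W) :
    inversionParity cs (cs.wordProd ω) t = (cs.rightInvSeq ω).count t := by
  simp [inversionParity, lift_parityStep_wordProd]

theorem lift_parityStep_apply (cs : CoxeterSystem M W) (w t : W) (e : ZMod 2) :
    cs.lift ⟨parityStep cs, isLiftable_parityStep cs⟩ w (t, e) =
      (w * t * w⁻¹, e + inversionParity cs w t) := by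
  obtain ⟨ω, rfl⟩ := cs.wordProd_surjective w
  rw [lift_parityStep_wordProd, inversionParity_wordProd]

theorem inversionParity_mul (cs : CoxeterSystem M W) (x y t : W) :
    inversionParity cs (x * y) t =
      inversionParity cs y t + inversionParity cs x (y * t * y⁻¹) := by
  rw [inversionParity, map_mul,
    show ∀ f g : Function.End (W × ZMod 2), (f * g) (t, 0) = f (g (t, 0)) from fun _ _ => rfl,
    lift_parityStep_apply, lift_parityStep_apply, zero_add]

theorem mem_rightInvSeq_of_inversionParity_ne_zero (cs : CoxeterSystem M W) {ω : List B} {t : W}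
    (h : inversionParity cs (cs.wordProd ω) t ≠ 0) : t ∈ cs.rightInvSeq ω := by
  classical
  by_contra hmem
  exact h (by rw [inversionParity_wordProd, List.count_eq_zero_of_not_mem hmem, Nat.cast_zero])

theorem length_mul_lt_of_inversionParity_ne_zero (cs : CoxeterSystem M W) {w t : W}
    (h : inversionParity cs w t ≠ 0) : cs.length (w * t) < cs.length w := by
  obtain ⟨ω, hω, rfl⟩ := cs.exists_isReduced w
  exact (cs.isRightInversion_of_mem_rightInvSeq hω
    (mem_rightInvSeq_of_inversionParity_ne_zero cs h)).2

theorem inversionParity_simple_self (cs : CoxeterSystem M W) (i : B) :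
    inversionParity cs (cs.simple i) (cs.simple i) = 1 := by
  classical
  simpa using inversionParity_wordProd cs [i] (cs.simple i)

theorem inversionParity_simple_ne_zero_iff (cs : CoxeterSystem M W) {w : W} {i : B} :
    inversionParity cs w (cs.simple i) ≠ 0 ↔ cs.IsRightDescent w i := by
  refine ⟨length_mul_lt_of_inversionParity_ne_zero cs, fun h h0 => ?_⟩
  have h1 : inversionParity cs (w * cs.simple i) (cs.simple i) ≠ 0 := by
    rw [inversionParity_mul, inversionParity_simple_self]
    simp [h0]
  have h2 := length_mul_lt_of_inversionParity_ne_zero cs h1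
  rw [cs.simple_mul_simple_cancel_right] at h2
  exact lt_asymm h h2

end InversionParity

/-- Every element of the standard parabolic subgroup generated by `J` has a reduced word with
letters in `J`. -/
theorem exists_isReduced_of_mem_closure (cs : CoxeterSystem M W) {J : Set B} {x : W}
    (hx : x ∈ Subgroup.closure (cs.simple '' J)) :
    ∃ ω : List B, cs.IsReduced ω ∧ (∀ i ∈ ω, i ∈ J) ∧ cs.wordProd ω = x := by
  have step : ∀ (x : W) (i : B), i ∈ J →
      (∃ ω : List B, cs.IsReduced ω ∧ (∀ i ∈ ω, i ∈ J) ∧ cs.wordProd ω = x) →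
      ∃ ω : List B, cs.IsReduced ω ∧ (∀ i ∈ ω, i ∈ J) ∧ cs.wordProd ω = x * cs.simple i := by
    rintro _ i hi ⟨ω, hω, hJ, rfl⟩
    by_cases hd : cs.IsRightDescent (cs.wordProd ω) i
    · obtain ⟨k, hk, hki⟩ := List.mem_iff_getElem.mp
        (mem_rightInvSeq_of_inversionParity_ne_zero cs
          ((inversionParity_simple_ne_zero_iff cs).mpr hd))
      have hprod := cs.wordProd_mul_getD_rightInvSeq ω k
      rw [List.getD_eq_getElem _ 1 hk, hki] at hprod
      rw [cs.length_rightInvSeq] at hk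
      refine ⟨ω.eraseIdx k, ?_, fun b hb => hJ b (List.mem_of_mem_eraseIdx hb), hprod.symm⟩
      have h1 := cs.isRightDescent_iff.mp hd
      have h2 := List.length_eraseIdx_add_one hk
      have h3 := hω.eq
      rw [hprod] at h1
      unfold CoxeterSystem.IsReduced
      lia
    · refine ⟨ω ++ [i], ?_, ?_, by simp [cs.wordProd_append]⟩
      · have h1 := cs.not_isRightDescent_iff.mp hd
        have h3 := hω.eq
        simp [CoxeterSystem.IsReduced, cs.wordProd_append, h1, h3]
      · intro b hb
        rcases List.mem_append.mp hb with hb | hb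
        · exact hJ b hb
        · rwa [List.mem_singleton.mp hb]
  induction hx using Subgroup.closure_induction_right with
  | one => exact ⟨[], by simp [CoxeterSystem.IsReduced], by simp, by simp⟩
  | mul_right x _ y hy ih =>
    obtain ⟨i, hi, rfl⟩ := hy
    exact step x i hi ih
  | mul_inv_cancel x _ y hy ih =>
    obtain ⟨i, hi, rfl⟩ := hy
    rw [cs.inv_simple]
    exact step x i hi ih

/-- If every element of `J` is a right descent of `g`, then every element of the standard
parabolic subgroup generated by `J` is a suffix of `g`. -/
theorem length_mul_inv_add_of_mem_closure (cs : CoxeterSystem M W) {J : Set B} {g x : W}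
    (hg : ∀ i ∈ J, cs.IsRightDescent g i) (hx : x ∈ Subgroup.closure (cs.simple '' J)) :
    cs.length (g * x⁻¹) + cs.length x = cs.length g := by
  obtain ⟨ω, hω, hJ, rfl⟩ := exists_isReduced_of_mem_closure cs hx
  clear hx
  induction ω using List.reverseRecOn with
  | nil => simp
  | append_singleton ω i ih =>
    have hω' : cs.IsReduced ω := by simpa using hω.take ω.length
    have ih := ih hω' fun b hb => hJ b (List.mem_append_left _ hb)
    set x := cs.wordProd ω with hxdef
    have hxi : cs.wordProd (ω ++ [i]) = x * cs.simple i := by simp [cs.wordProd_append, hxdef]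
    have hlen : cs.length (x * cs.simple i) = cs.length x + 1 := by
      rw [← hxi, hω.eq, hxdef, hω'.eq]; simp
    have hx0 : inversionParity cs x (cs.simple i) = 0 := by
      by_contra h
      have := length_mul_lt_of_inversionParity_ne_zero cs h
      lia
    have hg0 := (inversionParity_simple_ne_zero_iff cs).mpr (hg i (hJ i (by simp)))
    rw [show g = g * x⁻¹ * x by group, inversionParity_mul, hx0, zero_add] at hg0
    have hlt := length_mul_lt_of_inversionParity_ne_zero cs hg0
    have heq : g * x⁻¹ * (x * cs.simple i * x⁻¹) = g * (x * cs.simple i)⁻¹ := by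
      simp [mul_assoc]
    rw [heq] at hlt
    have hle := cs.length_mul_le (g * (x * cs.simple i)⁻¹) (x * cs.simple i)
    rw [inv_mul_cancel_right] at hle
    rw [hxi]
    lia

theorem exists_longest_mem_closure (cs : CoxeterSystem M W) {J : Set B} {g : W}
    (hg : ∀ i ∈ J, cs.IsRightDescent g i) :
    ∃ d ∈ Subgroup.closure (cs.simple '' J),
      ∀ x ∈ Subgroup.closure (cs.simple '' J), cs.length x ≤ cs.length d := by
  let S : Set ℕ := cs.length '' (Subgroup.closure (cs.simple '' J) : Set W)
  have hne : S.Nonempty := ⟨_, 1, one_mem _, rfl⟩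
  have hbdd : BddAbove S := by
    refine ⟨cs.length g, ?_⟩
    rintro _ ⟨x, hx, rfl⟩
    have := length_mul_inv_add_of_mem_closure cs hg hx
    lia
  obtain ⟨d, hd, hmax⟩ := Nat.sSup_mem hne hbdd
  refine ⟨d, hd, fun x hx => ?_⟩
  rw [hmax]
  exact le_csSup hbdd ⟨x, hx, rfl⟩

theorem isRightDescent_of_mul (cs : CoxeterSystem M W) {x v : W} {k : B}
    (hlen : cs.length (x * v) = cs.length x + cs.length v) (h : cs.IsRightDescent v k) :
    cs.IsRightDescent (x * v) k := by
  have := cs.length_mul_le x (v * cs.simple k)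
  unfold CoxeterSystem.IsRightDescent at *
  rw [mul_assoc]
  lia

theorem isLeftDescent_of_mul (cs : CoxeterSystem M W) {x v : W} {k : B}
    (hlen : cs.length (x * v) = cs.length x + cs.length v) (h : cs.IsLeftDescent x k) :
    cs.IsLeftDescent (x * v) k := by
  have := cs.length_mul_le (cs.simple k * x) v
  unfold CoxeterSystem.IsLeftDescent at *
  rw [← mul_assoc]
  lia

theorem setOf_isRightDescent_eq_of_mul (cs : CoxeterSystem M W) {x v : W} {j : B}
    (hlen : cs.length (x * v) = cs.length x + cs.length v) (hv : v ≠ 1)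
    (hD : {k : B | cs.IsRightDescent (x * v) k} = {j}) :
    {k : B | cs.IsRightDescent v k} = {j} := by
  have hsub : ∀ k, cs.IsRightDescent v k → k = j := fun k hk => by
    have : k ∈ {k : B | cs.IsRightDescent (x * v) k} := isRightDescent_of_mul cs hlen hk
    rwa [hD] at this
  obtain ⟨k, hk⟩ := cs.exists_rightDescent_of_ne_one hv
  ext b
  exact ⟨hsub b, fun hb => by rw [Set.mem_singleton_iff.mp hb, ← hsub k hk]; exact hk⟩

theorem InGamma.isLeftDescent {cs : CoxeterSystem M W} {w : W} {i j : B}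
    (h : InGamma cs (w, i, j)) : cs.IsLeftDescent w i := by
  have h1 : cs.length (cs.simple i * w * cs.simple j) + 2 = cs.length w := h
  have h2 := cs.length_mul_simple (cs.simple i * w) j
  unfold CoxeterSystem.IsLeftDescent
  lia

/-- A left reduction strictly decreasing the length forces a second left descent. -/
theorem exists_ne_isLeftDescent_of_redL (cs : CoxeterSystem M W) {w v : W} {i i' j j' : B}
    (h : RedL cs (w, i, j) (v, i', j')) (hlt : cs.length v < cs.length w) :
    ∃ k, k ≠ i ∧ cs.IsLeftDescent w k := by
  obtain ⟨-, -, hle, -, hconj, hup⟩ := h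
  simp only [WeakLeftLE] at hle hconj hup
  set x := w * v⁻¹ with hx
  have hw : x * v = w := by simp [hx]
  have hx1 : x ≠ 1 := by
    intro h1
    rw [h1, cs.length_one] at hle
    lia
  obtain ⟨k, hk⟩ := cs.exists_leftDescent_of_ne_one hx1
  refine ⟨k, ?_, hw ▸ isLeftDescent_of_mul cs (by rw [hw]; lia) hk⟩
  rintro rfl
  have : cs.simple k * x = x * cs.simple i' := by rw [← hconj]; group
  unfold CoxeterSystem.IsLeftDescent at hk
  rw [this] at hk
  lia

/-- If `w` has two distinct left descents `i` and `b`, splitting off from the left all but one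
letter of the longest element of the parabolic subgroup generated by `s_i` and `s_b` gives a left
reduction with the same unique right descent. -/
theorem exists_redL_of_isLeftDescent (cs : CoxeterSystem M W) {w : W} {i j b : B}
    (h : InGamma cs (w, i, j)) (hD : {k : B | cs.IsRightDescent w k} = {j}) (hbi : b ≠ i)
    (hb : cs.IsLeftDescent w b) :
    ∃ (v : W) (i' : B), InGamma cs (v, i', j) ∧ RedL cs (w, i, j) (v, i', j) ∧
      cs.length v < cs.length w ∧ {k : B | cs.IsRightDescent v k} = {j} := by
  let D := Subgroup.closure (cs.simple '' {i, b})
  have hiD : cs.simple i ∈ D := Subgroup.subset_closure ⟨i, by simp, rfl⟩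
  have hbD : cs.simple b ∈ D := Subgroup.subset_closure ⟨b, by simp, rfl⟩
  have hg : ∀ k ∈ ({i, b} : Set B), cs.IsRightDescent w⁻¹ k := by
    rintro k (rfl | rfl)
    · exact cs.isRightDescent_inv_iff.mpr h.isLeftDescent
    · exact cs.isRightDescent_inv_iff.mpr hb
  obtain ⟨d, hd, hmax⟩ := exists_longest_mem_closure cs hg
  have hsuffix : ∀ x ∈ D, cs.length (x * w) + cs.length x = cs.length w := by
    intro x hx
    rw [← length_mul_inv_add_of_mem_closure cs hg hx |>.trans (cs.length_inv w),
      ← cs.length_inv (x * w), mul_inv_rev]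
  have hlongest : ∀ x ∈ D, cs.length (d * x⁻¹) + cs.length x = cs.length d := by
    refine fun x hx => length_mul_inv_add_of_mem_closure cs (fun k hk => ?_) hx
    have hkD : cs.simple k ∈ D := Subgroup.subset_closure ⟨k, hk, rfl⟩
    exact lt_of_le_of_ne (hmax _ (mul_mem hd hkD)) (cs.length_mul_simple_ne d k)
  have hdi := hlongest _ hiD
  rw [cs.inv_simple, cs.length_simple] at hdi
  have hd2 : 2 ≤ cs.length d := by
    by_contra hlt
    have h1 : cs.length (d * cs.simple i) = 0 := by lia
    have h2 := hlongest _ hbD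
    rw [cs.inv_simple, cs.length_simple] at h2
    have h3 : cs.length (d * cs.simple b) = 0 := by lia
    rw [cs.length_eq_zero_iff] at h1 h3
    exact hbi (simple_injective cs (mul_left_cancel (h3.trans h1.symm)))
  obtain ⟨c, hc⟩ : ∃ c, d * cs.simple i * d⁻¹ = cs.simple c := by
    have := hlongest _ (mul_mem hd hiD)
    rw [← cs.length_eq_one_iff]
    have h2 : d * cs.simple i * d⁻¹ = d * (d * cs.simple i)⁻¹ := by simp [mul_assoc]
    rw [h2]
    lia
  have hdc : cs.simple c * d = d * cs.simple i := by rw [← hc]; group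
  have hu := hsuffix d hd
  have hv := hsuffix _ (mul_mem hd hiD)
  have hwv : w * (d * cs.simple i * w)⁻¹ = (d * cs.simple i)⁻¹ := by group
  have hdw : d * w ≠ 1 := by
    intro h1
    have hwd : w = d⁻¹ := eq_inv_of_mul_eq_one_right h1
    have hright : ∀ k ∈ ({i, b} : Set B), k = j := by
      intro k hk
      have hkD : cs.simple k ∈ D := Subgroup.subset_closure ⟨k, hk, rfl⟩
      have : k ∈ {k : B | cs.IsRightDescent w k} := by
        rw [Set.mem_ofPred_eq, hwd, cs.isRightDescent_inv_iff]
        exact lt_of_le_of_ne (hmax _ (mul_mem hkD hd)) (cs.length_simple_mul_ne d k)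
      rwa [hD] at this
    exact hbi ((hright b (by simp)).trans (hright i (by simp)).symm)
  have hDu : {k : B | cs.IsRightDescent (d * w) k} = {j} := by
    refine setOf_isRightDescent_eq_of_mul cs (x := d⁻¹) ?_ hdw ?_
    · rw [inv_mul_cancel_left, cs.length_inv]; lia
    · rwa [inv_mul_cancel_left]
  have huj : cs.IsRightDescent (d * w) j := by
    have : j ∈ {k : B | cs.IsRightDescent (d * w) k} := hDu ▸ Set.mem_singleton j
    exact this
  have hvc : cs.simple c * (d * cs.simple i * w) = d * w := by
    rw [← hdc]; simp [mul_assoc]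
  have hΓ : InGamma cs (d * cs.simple i * w, c, j) := by
    have := cs.isRightDescent_iff.mp huj
    simp only [InGamma, hvc]
    lia
  refine ⟨d * cs.simple i * w, c, hΓ, ⟨h, hΓ, ?_, rfl, ?_, ?_⟩, by lia, ?_⟩
  · simp only [WeakLeftLE, hwv, cs.length_inv]
    exact hv
  · simp only [hwv, inv_inv]
    rw [← hc]
    simp [mul_assoc]
  · simp only [hwv]
    rw [← cs.length_inv, ← cs.length_inv (d * cs.simple i)⁻¹, mul_inv_rev, inv_inv, cs.inv_simple,
      ← mul_assoc, hdc, cs.simple_mul_simple_cancel_right]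
    lia
  · refine setOf_isRightDescent_eq_of_mul cs (x := (d * cs.simple i)⁻¹) ?_ ?_ ?_
    · rw [inv_mul_cancel_left, cs.length_inv]; lia
    · intro h1
      rw [h1, cs.length_one] at hv
      lia
    · rwa [inv_mul_cancel_left]

/-- If `j` is the only right descent of `w`, a length-decreasing left reduction preserving
`D_R = {j}` exists iff `w` has more than one left descent. -/
theorem exists_redL_unique_right_descent_iff (cs : CoxeterSystem M W) (w : W) (i j : B)
    (h : InGamma cs (w, i, j)) (hD : {k : B | cs.IsRightDescent w k} = {j}) :
    (∃ (v : W) (i' : B), InGamma cs (v, i', j) ∧ RedL cs (w, i, j) (v, i', j) ∧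
        cs.length v < cs.length w ∧ {k : B | cs.IsRightDescent v k} = {j}) ↔
      (∃ a b : B, a ≠ b ∧ cs.IsLeftDescent w a ∧ cs.IsLeftDescent w b) := by
  constructor
  · rintro ⟨v, i', -, hred, hlt, -⟩
    obtain ⟨k, hki, hk⟩ := exists_ne_isLeftDescent_of_redL cs hred hlt
    exact ⟨k, i, hki, hk, h.isLeftDescent⟩
  · rintro ⟨a, b, hab, ha, hb⟩
    rcases eq_or_ne b i with rfl | hbi
    · exact exists_redL_of_isLeftDescent cs h hD hab ha
    · exact exists_redL_of_isLeftDescent cs h hD hbi hb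

end NilpotencyIndices
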